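/- Let Σ be a topologically transitive one-sided Markov shift over the countable alphabet ℤ₊ and A : Σ → ℝ a potential of summable variation. Suppose h_A(x̄,z) ∈ ℝ for some x̄, z ∈ Σ. Then the map y ↦ h_A(x̄,y) is a real-valued continuous function on Σ whose ℓ-th variation is bounded above by Var_ℓ^∞(A) for every ℓ ≥ 1; in particular, if ∑_{ℓ=1}^∞ Var_ℓ^∞(A) < ∞, then h_A(x̄,·) has summable variation. -/

import Mathlib

open MeasureTheory Filter Set
open scoped ENNReal

namespace CMS

/-- The one-sided Markov shift `Σ` over the countable alphabet `ℕ = ℤ₊`,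
determined by the transition matrix `Tr`. -/
abbrev SS (Tr : ℕ → ℕ → Prop) : Type := {x : ℕ → ℕ // ∀ n, Tr (x n) (x (n + 1))}

/-- The left shift map `σ`. -/
def shiftMap (Tr : ℕ → ℕ → Prop) (x : SS Tr) : SS Tr :=
  ⟨fun n => x.1 (n + 1), fun n => x.2 (n + 1)⟩

open scoped Classical in
/-- The metric `d(x,y) = λ^ℓ`, `ℓ` the first index of disagreement (`0` if `x = y`). -/
noncomputable def sdist (lam : ℝ) {Tr : ℕ → ℕ → Prop} (x y : SS Tr) : ℝ :=
  if h : ∃ n, x.1 n ≠ y.1 n then lam ^ Nat.find h else 0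

/-- Birkhoff sum `S_n f`. -/
noncomputable def birk {Tr : ℕ → ℕ → Prop} (f : SS Tr → ℝ) (n : ℕ) (x : SS Tr) : ℝ :=
  ∑ i ∈ Finset.range n, f ((shiftMap Tr)^[i] x)

/-- `ℓ`-th variation of `f` restricted to a subset `s` (valued in `ℝ≥0∞`). -/
noncomputable def varAtOn (lam : ℝ) {Tr : ℕ → ℕ → Prop} (s : Set (SS Tr))
    (f : SS Tr → ℝ) (ℓ : ℕ) : ℝ≥0∞ :=
  ⨆ (x ∈ s) (y ∈ s) (_ : sdist lam x y ≤ lam ^ ℓ), ENNReal.ofReal (f x - f y)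

/-- `ℓ`-th variation `Var_ℓ(f)`. -/
noncomputable def varAt (lam : ℝ) {Tr : ℕ → ℕ → Prop} (f : SS Tr → ℝ) (ℓ : ℕ) : ℝ≥0∞ :=
  varAtOn lam Set.univ f ℓ

/-- `Var_k^∞(f) = ∑_{ℓ ≥ k} Var_ℓ(f)`. -/
noncomputable def varFrom (lam : ℝ) {Tr : ℕ → ℕ → Prop} (f : SS Tr → ℝ) (k : ℕ) : ℝ≥0∞ :=
  ∑' ℓ : ℕ, varAt lam f (k + ℓ)

/-- `f` has summable variation: `Var_1^∞(f) < ∞`. -/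
def SummableVar (lam : ℝ) {Tr : ℕ → ℕ → Prop} (f : SS Tr → ℝ) : Prop :=
  varFrom lam f 1 < ⊤

/-- `f` is locally Hölder continuous: `Var_ℓ(f) ≤ C λ^ℓ` for all `ℓ ≥ 1`. -/
def LocHolder (lam : ℝ) {Tr : ℕ → ℕ → Prop} (f : SS Tr → ℝ) : Prop :=
  ∃ C : ℝ, 0 < C ∧ ∀ ℓ : ℕ, 1 ≤ ℓ → varAt lam f ℓ ≤ ENNReal.ofReal (C * lam ^ ℓ)

/-- `‖A - B‖_sv = Var_1^∞(A-B) + ‖A-B‖_∞`. -/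
noncomputable def svDist (lam : ℝ) {Tr : ℕ → ℕ → Prop} (A B : SS Tr → ℝ) : ℝ≥0∞ :=
  varFrom lam (fun x => A x - B x) 1 + ⨆ x : SS Tr, ENNReal.ofReal |A x - B x|

/-- `A` is a potential: continuous and bounded from above. -/
def IsPotential {Tr : ℕ → ℕ → Prop} (A : SS Tr → ℝ) : Prop :=
  Continuous A ∧ BddAbove (Set.range A)

/-- Topological transitivity of the shift. -/
def TopTransitive (Tr : ℕ → ℕ → Prop) : Prop :=
  ∀ U V : Set (SS Tr), IsOpen U → IsOpen V → U.Nonempty → V.Nonempty →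
    ∃ n : ℕ, ((shiftMap Tr)^[n] '' U ∩ V).Nonempty

/-- The ergodic maximizing constant `β_A`. -/
noncomputable def beta {Tr : ℕ → ℕ → Prop} (A : SS Tr → ℝ) : ℝ :=
  sSup {r : ℝ | ∃ μ : Measure (SS Tr), IsProbabilityMeasure μ ∧
    μ.map (shiftMap Tr) = μ ∧ r = ∫ x, A x ∂μ}

/-- `μ` is an `A`-maximizing (shift-invariant Borel probability) measure. -/
def Maximizing {Tr : ℕ → ℕ → Prop} (A : SS Tr → ℝ) (μ : Measure (SS Tr)) : Prop :=
  IsProbabilityMeasure μ ∧ μ.map (shiftMap Tr) = μ ∧ ∫ x, A x ∂μ = beta A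

/-- Topological support of a measure. -/
def msupport {Tr : ℕ → ℕ → Prop} (μ : Measure (SS Tr)) : Set (SS Tr) :=
  {x | ∀ U : Set (SS Tr), IsOpen U → x ∈ U → 0 < μ U}

/-- `μ` is the uniform probability measure on a periodic orbit. -/
def PeriodicOrbitMeasure {Tr : ℕ → ℕ → Prop} (μ : Measure (SS Tr)) : Prop :=
  ∃ (y : SS Tr) (p : ℕ), 1 ≤ p ∧ (shiftMap Tr)^[p] y = y ∧
    μ = (p : ℝ≥0∞)⁻¹ • ∑ i ∈ Finset.range p, Measure.dirac ((shiftMap Tr)^[i] y)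

/-- `A` is coercive: `lim_{i→∞} sup A|_[i] = -∞`. -/
def Coercive {Tr : ℕ → ℕ → Prop} (A : SS Tr → ℝ) : Prop :=
  ∀ M : ℝ, ∃ N : ℕ, ∀ i : ℕ, N ≤ i → ∀ x : SS Tr, x.1 0 = i → A x ≤ M

/-- The Aubry set `Ω(A)`. -/
def Aubry (lam : ℝ) {Tr : ℕ → ℕ → Prop} (A : SS Tr → ℝ) : Set (SS Tr) :=
  {x | ∀ ε : ℝ, 0 < ε → ∃ (w : SS Tr) (n : ℕ), 0 < n ∧
    sdist lam x w < ε ∧ sdist lam ((shiftMap Tr)^[n] w) x < ε ∧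
    -ε < (n : ℝ) * beta A - birk A n w ∧ (n : ℝ) * beta A - birk A n w < ε}

/-- The auxiliary function `𝔖^k_l(x,y)` at level `γ`. -/
noncomputable def aux (lam : ℝ) {Tr : ℕ → ℕ → Prop} (A : SS Tr → ℝ) (γ : ℝ)
    (k l : ℕ) (x y : SS Tr) : EReal :=
  ⨅ (n : ℕ) (_ : l ≤ n) (w : SS Tr)
    (_ : sdist lam x w ≤ lam ^ k) (_ : sdist lam ((shiftMap Tr)^[n] w) y ≤ lam ^ k),
    (((n : ℝ) * γ - birk A n w : ℝ) : EReal)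

/-- The Mañé potential `φ^γ_A(x,y)`. -/
noncomputable def mane (lam : ℝ) {Tr : ℕ → ℕ → Prop} (A : SS Tr → ℝ) (γ : ℝ)
    (x y : SS Tr) : EReal :=
  ⨆ k : ℕ, aux lam A γ k 1 x y

/-- The Peierls barrier `h^γ_A(x,y)`. -/
noncomputable def peierls (lam : ℝ) {Tr : ℕ → ℕ → Prop} (A : SS Tr → ℝ) (γ : ℝ)
    (x y : SS Tr) : EReal :=
  ⨆ (k : ℕ) (l : ℕ), aux lam A γ k (l + 1) x y

section Shift

variable {Tr : ℕ → ℕ → Prop}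

lemma shiftMap_iterate_apply (n : ℕ) (x : SS Tr) (i : ℕ) :
    ((shiftMap Tr)^[n] x).1 i = x.1 (n + i) := by
  induction n generalizing x with
  | zero => simp
  | succ n ih =>
    rw [Function.iterate_succ_apply, ih]
    change x.1 (n + i + 1) = _
    rw [Nat.add_right_comm]

lemma sdist_le_pow_iff {lam : ℝ} (hlam0 : 0 < lam) (hlam1 : lam < 1) (x y : SS Tr) (k : ℕ) :
    sdist lam x y ≤ lam ^ k ↔ ∀ i < k, x.1 i = y.1 i := by
  classical
  unfold sdist
  split_ifs with h
  · rw [pow_le_pow_iff_right_of_lt_one₀ hlam0 hlam1, Nat.le_find_iff]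
    simp
  · push Not at h
    simp [h, hlam0.le]

/-- The word made of the first `n` letters of `w`, followed by `v`. -/
def splice (w : SS Tr) (n : ℕ) (v : SS Tr) (h : w.1 n = v.1 0) : SS Tr :=
  ⟨fun i => if i < n then w.1 i else v.1 (i - n), fun i => by
    rcases lt_trichotomy (i + 1) n with hi | hi | hi
    · simpa [hi, (Nat.lt_succ_self i).trans hi] using w.2 i
    · subst hi
      simpa [← h] using w.2 i
    · have h1 : ¬ i < n := by omega
      have h2 : ¬ i + 1 < n := by omega
      have h3 : i + 1 - n = i - n + 1 := by omega
      simpa [h1, h2, h3] using v.2 (i - n)⟩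

lemma splice_apply_of_lt (w v : SS Tr) {n : ℕ} (h : w.1 n = v.1 0) {i : ℕ} (hi : i < n) :
    (splice w n v h).1 i = w.1 i :=
  if_pos hi

lemma splice_apply_add (w v : SS Tr) {n : ℕ} (h : w.1 n = v.1 0) (i : ℕ) :
    (splice w n v h).1 (n + i) = v.1 i := by
  simp [splice]

lemma shiftMap_iterate_splice (w v : SS Tr) {n : ℕ} (h : w.1 n = v.1 0) :
    (shiftMap Tr)^[n] (splice w n v h) = v := by
  ext i
  rw [shiftMap_iterate_apply, splice_apply_add]

lemma birk_add (f : SS Tr → ℝ) (m n : ℕ) (x : SS Tr) :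
    birk f (m + n) x = birk f m x + birk f n ((shiftMap Tr)^[m] x) := by
  simp only [birk, Finset.sum_range_add, ← Function.iterate_add_apply, add_comm]

lemma isOpen_cylinder (x : SS Tr) (k : ℕ) : IsOpen {y : SS Tr | ∀ i < k, y.1 i = x.1 i} := by
  have h : {y : SS Tr | ∀ i < k, y.1 i = x.1 i} =
      ⋂ i ∈ Finset.range k, (fun y : SS Tr => y.1 i) ⁻¹' {x.1 i} := by
    ext y
    simp
  rw [h]
  refine isOpen_biInter_finset fun i _ => ?_
  exact (isOpen_discrete _).preimage ((continuous_apply i).comp continuous_subtype_val)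

lemma TopTransitive.exists_connection (htr : TopTransitive Tr) (y z : SS Tr) :
    ∃ (m : ℕ) (v : SS Tr), v.1 0 = z.1 0 ∧ (shiftMap Tr)^[m] v = y := by
  obtain ⟨m, -, ⟨v, hv, rfl⟩, hy⟩ := htr _ _ (isOpen_cylinder z 1) (isOpen_cylinder y 1)
    ⟨z, fun _ _ => rfl⟩ ⟨y, fun _ _ => rfl⟩
  have hvy : v.1 m = y.1 0 := by simpa [shiftMap_iterate_apply] using hy
  have hvz : v.1 0 = z.1 0 := by simpa using hv
  refine ⟨m, splice v m y hvy, ?_, shiftMap_iterate_splice v y hvy⟩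
  rcases Nat.eq_zero_or_pos m with rfl | hm
  · rw [← hvz, hvy]
    exact splice_apply_add v y hvy 0
  · rw [splice_apply_of_lt v y hvy hm, hvz]

end Shift

section Variation

variable {lam : ℝ} {Tr : ℕ → ℕ → Prop} {f : SS Tr → ℝ}

lemma ofReal_sub_le_varAt (hlam0 : 0 < lam) (hlam1 : lam < 1) {x y : SS Tr} {k : ℕ}
    (h : ∀ i < k, x.1 i = y.1 i) : ENNReal.ofReal (f x - f y) ≤ varAt lam f k :=
  le_iSup₂_of_le x (mem_univ x) <| le_iSup₂_of_le y (mem_univ y) <|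
    le_iSup_of_le ((sdist_le_pow_iff hlam0 hlam1 x y k).2 h) le_rfl

lemma varAt_le (hlam0 : 0 < lam) (hlam1 : lam < 1) {k : ℕ} {c : ℝ≥0∞}
    (h : ∀ x y : SS Tr, (∀ i < k, x.1 i = y.1 i) → ENNReal.ofReal (f x - f y) ≤ c) :
    varAt lam f k ≤ c :=
  iSup₂_le fun x _ => iSup₂_le fun y _ => iSup_le fun hxy =>
    h x y ((sdist_le_pow_iff hlam0 hlam1 x y k).1 hxy)

lemma ofReal_birk_sub_le_varFrom (hlam0 : 0 < lam) (hlam1 : lam < 1) {x y : SS Tr} {n k : ℕ}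
    (h : ∀ i < n + k, x.1 i = y.1 i) :
    ENNReal.ofReal (birk f n x - birk f n y) ≤ varFrom lam f k := by
  refine le_trans ?_ (ENNReal.sum_le_tsum (Finset.range n))
  induction n generalizing x y with
  | zero => simp [birk]
  | succ n ih =>
    have hx (x : SS Tr) : birk f (n + 1) x = birk f n (shiftMap Tr x) + f x := by
      rw [add_comm n 1, birk_add]
      simp [birk, add_comm]
    rw [hx, hx, add_sub_add_comm, Finset.sum_range_succ]
    refine ENNReal.ofReal_add_le.trans (add_le_add (ih fun i hi => h (i + 1) (by omega)) ?_)
    exact ofReal_sub_le_varAt hlam0 hlam1 fun i hi => h i (by omega)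

lemma SummableVar.varFrom_lt_top (hf : SummableVar lam f) {k : ℕ} (hk : 1 ≤ k) :
    varFrom lam f k < ⊤ := by
  obtain ⟨m, rfl⟩ := Nat.exists_eq_add_of_le hk
  refine lt_of_le_of_lt ?_ hf
  simp only [varFrom, add_assoc]
  exact ENNReal.tsum_comp_le_tsum_of_injective (add_right_injective m)
    fun j => varAt lam f (1 + j)

lemma SummableVar.tendsto_varFrom (hf : SummableVar lam f) :
    Tendsto (varFrom lam f) atTop (nhds 0) := by
  have h := ENNReal.tendsto_sum_nat_add (fun j => varAt lam f (1 + j)) hf.ne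
  rw [← tendsto_add_atTop_iff_nat 1]
  refine h.congr fun i => tsum_congr fun j => ?_
  congr 1
  omega

lemma continuous_of_varAt_tendsto_zero (hlam0 : 0 < lam) (hlam1 : lam < 1)
    (h : Tendsto (varAt lam f) atTop (nhds 0)) : Continuous f := by
  refine continuous_iff_continuousAt.2 fun x => Metric.tendsto_nhds.2 fun ε hε => ?_
  obtain ⟨k, hk⟩ := (h.eventually_lt_const (ENNReal.ofReal_pos.2 hε)).exists
  filter_upwards [(isOpen_cylinder x k).mem_nhds fun _ _ => rfl] with y hy
  have hlt {a b : SS Tr} (hab : ∀ i < k, a.1 i = b.1 i) : f a - f b < ε :=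
    (ENNReal.ofReal_lt_ofReal_iff hε).1
      ((ofReal_sub_le_varAt hlam0 hlam1 hab).trans_lt hk)
  rw [Real.dist_eq, abs_lt]
  have h1 := hlt hy
  have h2 := hlt fun i hi => (hy i hi).symm
  constructor <;> linarith

end Variation

section Peierls

variable {lam : ℝ} {Tr : ℕ → ℕ → Prop} {A : SS Tr → ℝ}

lemma aux_le (hlam0 : 0 < lam) (hlam1 : lam < 1) {γ : ℝ} {k l n : ℕ} {x y w : SS Tr} (hn : l ≤ n)
    (hx : ∀ i < k, x.1 i = w.1 i) (hy : ∀ i < k, w.1 (n + i) = y.1 i) :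
    aux lam A γ k l x y ≤ ((n * γ - birk A n w : ℝ) : EReal) :=
  iInf₂_le_of_le n hn <| iInf₂_le_of_le w ((sdist_le_pow_iff hlam0 hlam1 x w k).2 hx) <|
    iInf_le_of_le ((sdist_le_pow_iff hlam0 hlam1 _ y k).2 fun i hi => by
      rw [shiftMap_iterate_apply, hy i hi]) le_rfl

lemma le_aux (hlam0 : 0 < lam) (hlam1 : lam < 1) {γ : ℝ} {k l : ℕ} {x y : SS Tr} {c : EReal}
    (h : ∀ (n : ℕ) (w : SS Tr), l ≤ n → (∀ i < k, x.1 i = w.1 i) →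
      (∀ i < k, w.1 (n + i) = y.1 i) → c ≤ ((n * γ - birk A n w : ℝ) : EReal)) :
    c ≤ aux lam A γ k l x y :=
  le_iInf₂ fun n hn => le_iInf₂ fun w hx => le_iInf fun hy =>
    h n w hn ((sdist_le_pow_iff hlam0 hlam1 x w k).1 hx) fun i hi => by
      rw [← (sdist_le_pow_iff hlam0 hlam1 _ y k).1 hy i hi, shiftMap_iterate_apply]

/-- Moving the endpoint of the Peierls barrier from `z` to `σᵐ v`, where `v` is close to `z`,
costs at most the action of `v` plus a variation of `A`. -/
lemma peierls_iterate_le (hlam0 : 0 < lam) (hlam1 : lam < 1) (hA : SummableVar lam A)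
    (γ : ℝ) (x : SS Tr) {z v : SS Tr} {ℓ : ℕ} (hℓ : 1 ≤ ℓ) (hv : ∀ i < ℓ, z.1 i = v.1 i) (m : ℕ) :
    peierls lam A γ x ((shiftMap Tr)^[m] v) ≤
      peierls lam A γ x z + (((varFrom lam A ℓ).toReal + (m * γ - birk A m v) : ℝ) : EReal) := by
  set c : ℝ := (varFrom lam A ℓ).toReal + (m * γ - birk A m v) with hc
  refine iSup₂_le fun k l => ?_
  suffices h : aux lam A γ k (l + 1) x ((shiftMap Tr)^[m] v) - (c : EReal) ≤
      aux lam A γ (max k ℓ) (max k l + 1) x z by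
    refine (EReal.sub_le_iff_le_add (.inl (EReal.coe_ne_bot c)) (.inl (EReal.coe_ne_top c))).1
      (h.trans ?_)
    exact le_iSup₂_of_le (max k ℓ) (max k l) le_rfl
  refine le_aux hlam0 hlam1 fun n w hn hx hz => ?_
  have hwz (i : ℕ) (hi : i < ℓ) : w.1 (n + i) = v.1 i :=
    (hz i (lt_max_of_lt_right hi)).trans (hv i hi)
  have hw : w.1 n = v.1 0 := hwz 0 hℓ
  have hxw (i : ℕ) (hi : i < k) : x.1 i = (splice w n v hw).1 i := by
    rw [splice_apply_of_lt w v hw (by omega), hx i (lt_max_of_lt_left hi)]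
  have hy (i : ℕ) (_ : i < k) :
      (splice w n v hw).1 (n + m + i) = ((shiftMap Tr)^[m] v).1 i := by
    rw [add_assoc, splice_apply_add, shiftMap_iterate_apply]
  have hbirk : birk A n w - birk A n (splice w n v hw) ≤ (varFrom lam A ℓ).toReal := by
    rw [← ENNReal.ofReal_le_iff_le_toReal (hA.varFrom_lt_top hℓ).ne]
    refine ofReal_birk_sub_le_varFrom hlam0 hlam1 fun i hi => ?_
    rcases lt_or_ge i n with hin | hin
    · rw [splice_apply_of_lt w v hw hin]
    · obtain ⟨j, rfl⟩ := Nat.exists_eq_add_of_le hin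
      rw [splice_apply_add, hwz j (by omega)]
  rw [EReal.sub_le_iff_le_add (.inl (EReal.coe_ne_bot c)) (.inl (EReal.coe_ne_top c))]
  refine (aux_le hlam0 hlam1 (by omega) hxw hy).trans ?_
  rw [← EReal.coe_add, EReal.coe_le_coe_iff, birk_add, shiftMap_iterate_splice, hc]
  push_cast
  linarith

lemma exists_peierls_le_add (hlam0 : 0 < lam) (hlam1 : lam < 1) (htr : TopTransitive Tr)
    (hA : SummableVar lam A) (γ : ℝ) (x y z : SS Tr) :
    ∃ c : ℝ, peierls lam A γ x y ≤ peierls lam A γ x z + (c : EReal) := by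
  obtain ⟨m, v, hvz, rfl⟩ := htr.exists_connection y z
  refine ⟨_, peierls_iterate_le hlam0 hlam1 hA γ x le_rfl (fun i hi => ?_) m⟩
  obtain rfl : i = 0 := by omega
  exact hvz.symm

end Peierls

theorem peierls_regularity_second_variable
    (lam : ℝ) (hlam0 : 0 < lam) (hlam1 : lam < 1)
    (Tr : ℕ → ℕ → Prop) (htr : TopTransitive Tr)
    (A : SS Tr → ℝ) (hA : IsPotential A) (hAsv : SummableVar lam A)
    (xbar z : SS Tr) (hfin : ∃ r : ℝ, peierls lam A (beta A) xbar z = (r : EReal)) :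
    ∃ u : SS Tr → ℝ,
      (∀ y : SS Tr, peierls lam A (beta A) xbar y = (u y : EReal)) ∧
      Continuous u ∧
      (∀ ℓ : ℕ, 1 ≤ ℓ → varAt lam u ℓ ≤ varFrom lam A ℓ) ∧
      ((∑' ℓ : ℕ, varFrom lam A (1 + ℓ)) < ⊤ → SummableVar lam u) := by
  obtain ⟨r, hr⟩ := hfin
  have hreal (y : SS Tr) : peierls lam A (beta A) xbar y =
      ((peierls lam A (beta A) xbar y).toReal : EReal) := by
    obtain ⟨c, hc⟩ := exists_peierls_le_add hlam0 hlam1 htr hAsv (beta A) xbar y z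
    obtain ⟨c', hc'⟩ := exists_peierls_le_add hlam0 hlam1 htr hAsv (beta A) xbar z y
    refine (EReal.coe_toReal (fun htop => ?_) fun hbot => ?_).symm
    · rw [htop, hr, ← EReal.coe_add, top_le_iff] at hc
      exact EReal.coe_ne_top _ hc
    · rw [hbot, hr, EReal.bot_add, le_bot_iff] at hc'
      exact EReal.coe_ne_bot _ hc'
  have hvar (ℓ : ℕ) (hℓ : 1 ≤ ℓ) :
      varAt lam (fun y => (peierls lam A (beta A) xbar y).toReal) ℓ ≤ varFrom lam A ℓ := by
    refine varAt_le hlam0 hlam1 fun x y hxy => ?_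
    have h := peierls_iterate_le hlam0 hlam1 hAsv (beta A) xbar hℓ
      (fun i hi => (hxy i hi).symm) 0
    rw [Function.iterate_zero_apply, hreal x, hreal y, ← EReal.coe_add,
      EReal.coe_le_coe_iff] at h
    rw [ENNReal.ofReal_le_iff_le_toReal (hAsv.varFrom_lt_top hℓ).ne]
    simp only [birk, Finset.range_zero, Finset.sum_empty, Nat.cast_zero, zero_mul, sub_zero,
      add_zero] at h
    linarith
  refine ⟨_, hreal, ?_, hvar, fun h => ?_⟩
  · exact continuous_of_varAt_tendsto_zero hlam0 hlam1 <|
      tendsto_of_tendsto_of_tendsto_of_le_of_le' tendsto_const_nhds hAsv.tendsto_varFrom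
        (.of_forall fun _ => zero_le) (eventually_atTop.2 ⟨1, hvar⟩)
  · exact (ENNReal.tsum_le_tsum fun j => hvar (1 + j) (Nat.le_add_right 1 j)).trans_lt h

end CMS
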